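/- For every integer m ≥ 2, B(1/2, 2/(2m+3)) − B(1/2, 2/(2m+1)) ≥ 1. -/

import Mathlib

/-- The Beta function `B(a,b) = Γ(a)Γ(b)/Γ(a+b)`. -/
noncomputable def Beta (a b : ℝ) : ℝ :=
  Real.Gamma a * Real.Gamma b / Real.Gamma (a + b)

open Set MeasureTheory in
theorem intervalIntegrable_rpow_mul_one_sub_rpow {u v : ℝ} (hu : 0 < u) (hv : 0 < v) :
    IntervalIntegrable (fun t : ℝ => t ^ (u - 1) * (1 - t) ^ (v - 1)) volume 0 1 := by
  have h := Complex.betaIntegral_convergent (u := (u : ℂ)) (v := (v : ℂ)) (by simpa) (by simpa)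
  rw [intervalIntegrable_iff_integrableOn_Ioc_of_le zero_le_one] at h ⊢
  refine IntegrableOn.congr_fun (Integrable.re h) (fun t ht => ?_) measurableSet_Ioc
  have h1 : (0 : ℝ) ≤ 1 - t := sub_nonneg.2 ht.2
  simp only [← Complex.ofReal_one, ← Complex.ofReal_sub, ← Complex.ofReal_cpow ht.1.le,
    ← Complex.ofReal_cpow h1, ← Complex.ofReal_mul]
  exact Complex.ofReal_re _

theorem Beta_eq_integral {u v : ℝ} (hu : 0 < u) (hv : 0 < v) :
    Beta u v = ∫ t in (0 : ℝ)..1, t ^ (u - 1) * (1 - t) ^ (v - 1) := by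
  have h : Complex.betaIntegral u v =
      ((∫ t in (0 : ℝ)..1, t ^ (u - 1) * (1 - t) ^ (v - 1) : ℝ) : ℂ) := by
    rw [Complex.betaIntegral, ← intervalIntegral.integral_ofReal]
    refine intervalIntegral.integral_congr fun t ht => ?_
    rw [Set.uIcc_of_le zero_le_one] at ht
    have h1 : (0 : ℝ) ≤ 1 - t := sub_nonneg.2 ht.2
    simp only [← Complex.ofReal_one, ← Complex.ofReal_sub, ← Complex.ofReal_cpow ht.1,
      ← Complex.ofReal_cpow h1, ← Complex.ofReal_mul]
  have hβ : Beta u v = (Complex.betaIntegral u v).re :=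
    ProbabilityTheory.beta_eq_betaIntegralReal u v hu hv
  rw [hβ, h, Complex.ofReal_re]

theorem Beta_one_left {v : ℝ} (hv : 0 < v) : Beta 1 v = 1 / v := by
  have := (Real.Gamma_pos_of_pos hv).ne'
  rw [Beta, Real.Gamma_one, add_comm, Real.Gamma_add_one hv.ne']
  field_simp

/-- For `0 < a ≤ 1`, the function `x ↦ B(a, x) - 1 / x` is antitone on `(0, ∞)`. -/
theorem antitoneOn_Beta_sub_one_div {a : ℝ} (ha : 0 < a) (ha1 : a ≤ 1) :
    AntitoneOn (fun x => Beta a x - 1 / x) (Set.Ioi 0) := by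
  intro p hp q hq hpq
  have hp' : 0 < p := hp
  have hq' : 0 < q := hq
  have hint {x : ℝ} (hx : 0 < x) :=
    (intervalIntegrable_rpow_mul_one_sub_rpow ha hx).sub
      (intervalIntegrable_rpow_mul_one_sub_rpow one_pos hx)
  have heq {x : ℝ} (hx : 0 < x) := intervalIntegral.integral_sub
    (intervalIntegrable_rpow_mul_one_sub_rpow ha hx)
    (intervalIntegrable_rpow_mul_one_sub_rpow one_pos hx)
  simp only [← Beta_one_left hp', ← Beta_one_left hq', Beta_eq_integral ha hp',
    Beta_eq_integral ha hq', Beta_eq_integral one_pos hp', Beta_eq_integral one_pos hq',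
    ← heq hp', ← heq hq']
  refine intervalIntegral.integral_mono_on_of_le_Ioo zero_le_one (hint hq') (hint hp')
    fun t ht => ?_
  rw [← sub_mul, ← sub_mul, sub_self, Real.rpow_zero]
  refine mul_le_mul_of_nonneg_left ?_ (sub_nonneg.2 ?_)
  · exact Real.rpow_le_rpow_of_exponent_ge (by linarith [ht.2]) (by linarith [ht.1]) (by linarith)
  · exact Real.one_le_rpow_of_pos_of_le_one_of_nonpos ht.1 ht.2.le (by linarith)

/-- For every integer `m ≥ 2`, `B(1/2, 2/(2m+3)) - B(1/2, 2/(2m+1)) ≥ 1`. -/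
theorem stmt_16 (m : ℕ) (hm : 2 ≤ m) :
    1 ≤ Beta (1/2) (2/(2*(m : ℝ) + 3)) - Beta (1/2) (2/(2*(m : ℝ) + 1)) := by
  have h := antitoneOn_Beta_sub_one_div (a := 1 / 2) (by norm_num) (by norm_num)
    (Set.mem_Ioi.2 (by positivity : (0 : ℝ) < 2 / (2 * m + 3)))
    (Set.mem_Ioi.2 (by positivity : (0 : ℝ) < 2 / (2 * m + 1)))
    (by gcongr; norm_num)
  simp only [one_div_div] at h
  linarith
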